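/- Fix N > 0 and T₀ > 0, and set N₀ = (T₀N+4)/2. There exists C > 0, depending only on T₀ and N (independent of δ), such that for all 0 < δ < 1, t ∈ [0,T₀] and ξ ∈ ℝ: |∂_t M_δ(t,ξ)| ≤ N log(⟨ξ⟩) M_δ(t,ξ); and for all θ with |θ| ≤ π/4: M_δ(t,ξ) ≤ C M_δ(t, ξ cos θ), |M_δ(t,ξ) − M_δ(t, ξ cos θ)| ≤ C sin²(θ/2) M_δ(t, ξ cos θ), |(∂_ξ M_δ)(t,ξ) − (∂_ξ M_δ)(t, ξ cos θ)| ≤ C sin²(θ/2) ⟨ξ⟩^{−1} M_δ(t, ξ cos θ), and |(∂²_ξ M_δ)(t,ξ) − (∂²_ξ M_δ)(t, ξ cos θ)| ≤ C sin²(θ/2) ⟨ξ⟩^{−2} M_δ(t, ξ cos θ). -/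

import Mathlib

open MeasureTheory Real

noncomputable section

/-- Japanese bracket `⟨ξ⟩ = (1+ξ²)^{1/2}`. -/
def jap (v : ℝ) : ℝ := Real.sqrt (1 + v ^ 2)

/-- The polynomial mollifier `M_δ(t,ξ) = ⟨ξ⟩^{tN−1} (1+δξ²)^{−N₀}` with
`N₀ = (T₀N+4)/2`. -/
def Mmol (N T₀ δ t ξ : ℝ) : ℝ :=
  jap ξ ^ (t * N - 1) * (1 + δ * ξ ^ 2) ^ (-((T₀ * N + 4) / 2))
theorem one_le_jap (x : ℝ) : 1 ≤ jap x := by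
  rw [jap, Real.one_le_sqrt]
  nlinarith [sq_nonneg x]

theorem jap_pos (x : ℝ) : 0 < jap x := one_pos.trans_le (one_le_jap x)

theorem jap_sq (x : ℝ) : jap x ^ 2 = 1 + x ^ 2 :=
  Real.sq_sqrt (by positivity)

theorem abs_le_jap (x : ℝ) : |x| ≤ jap x :=
  abs_le_of_sq_le_sq (by rw [jap_sq]; linarith) (jap_pos x).le

theorem jap_inv_le_two_mul {x y : ℝ} (h : x ^ 2 ≤ 2 * y ^ 2) :
    (jap y)⁻¹ ≤ 2 * (jap x)⁻¹ := by
  have hx := jap_pos x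
  have hy := jap_pos y
  have : jap x ≤ 2 * jap y := by
    apply le_of_sq_le_sq _ (by positivity)
    rw [mul_pow, jap_sq, jap_sq]
    nlinarith [sq_nonneg y]
  rw [← div_eq_mul_inv, inv_eq_one_div, div_le_div_iff₀ hy hx]
  linarith

/-- Half the logarithmic derivative of `1 + d x²`. -/
def halfLogDeriv (d x : ℝ) : ℝ := d * x / (1 + d * x ^ 2)

/-- The coefficient `d / (1 + d x²)`. -/
def quadRatio (d x : ℝ) : ℝ := d / (1 + d * x ^ 2)

section

variable {d : ℝ}

theorem one_add_mul_sq_pos (hd : 0 < d) (x : ℝ) : 0 < 1 + d * x ^ 2 := by positivity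

theorem hasDerivAt_one_add_mul_sq (d x : ℝ) :
    HasDerivAt (fun y : ℝ => 1 + d * y ^ 2) (2 * (d * x)) x := by
  refine HasDerivAt.congr_deriv (((hasDerivAt_pow 2 x).const_mul d).const_add 1) ?_
  push_cast
  ring

theorem hasDerivAt_quadRatio (hd : 0 < d) (x : ℝ) :
    HasDerivAt (quadRatio d) (-2 * halfLogDeriv d x * quadRatio d x) x := by
  have h := one_add_mul_sq_pos hd x
  refine HasDerivAt.congr_deriv
    ((hasDerivAt_const x d).div (hasDerivAt_one_add_mul_sq d x) h.ne') ?_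
  rw [halfLogDeriv, quadRatio]
  field_simp
  ring

theorem hasDerivAt_halfLogDeriv (hd : 0 < d) (x : ℝ) :
    HasDerivAt (halfLogDeriv d) (quadRatio d x - 2 * halfLogDeriv d x ^ 2) x := by
  have h := one_add_mul_sq_pos hd x
  refine HasDerivAt.congr_deriv
    (((hasDerivAt_id x).const_mul d).div (hasDerivAt_one_add_mul_sq d x) h.ne') ?_
  rw [halfLogDeriv, quadRatio]
  simp only [id]
  field_simp

theorem hasDerivAt_one_add_mul_sq_rpow (hd : 0 < d) (c x : ℝ) :
    HasDerivAt (fun y : ℝ => (1 + d * y ^ 2) ^ c)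
      (2 * c * halfLogDeriv d x * (1 + d * x ^ 2) ^ c) x := by
  have h := one_add_mul_sq_pos hd x
  refine HasDerivAt.congr_deriv
    ((hasDerivAt_one_add_mul_sq d x).rpow_const (p := c) (Or.inl h.ne')) ?_
  rw [Real.rpow_sub_one h.ne', halfLogDeriv]
  ring

theorem abs_halfLogDeriv_le (hd : 0 < d) (hd1 : d ≤ 1) (x : ℝ) :
    |halfLogDeriv d x| ≤ (jap x)⁻¹ := by
  have h := one_add_mul_sq_pos hd x
  have hj := jap_pos x
  rw [halfLogDeriv, abs_div, abs_of_pos h, inv_eq_one_div, div_le_div_iff₀ h hj, one_mul]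
  apply le_of_sq_le_sq _ h.le
  rw [mul_pow, jap_sq, sq_abs]
  nlinarith [mul_nonneg (mul_nonneg hd.le (sq_nonneg x)) (sub_nonneg.2 hd1),
    mul_nonneg hd.le (sq_nonneg x)]

theorem abs_quadRatio_le (hd : 0 < d) (hd1 : d ≤ 1) (x : ℝ) :
    |quadRatio d x| ≤ (jap x)⁻¹ ^ 2 := by
  have h := one_add_mul_sq_pos hd x
  rw [quadRatio, abs_div, abs_of_pos h, abs_of_pos hd, inv_pow, jap_sq, inv_eq_one_div,
    div_le_div_iff₀ h (by positivity)]
  linarith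

theorem abs_quadRatio_sub_le (hd : 0 < d) (hd1 : d ≤ 1) (x : ℝ) :
    |quadRatio d x - 2 * halfLogDeriv d x ^ 2| ≤ 3 * (jap x)⁻¹ ^ 2 := by
  have hu := abs_halfLogDeriv_le hd hd1 x
  have hv := abs_quadRatio_le hd hd1 x
  calc _ ≤ |quadRatio d x| + |2 * halfLogDeriv d x ^ 2| := abs_sub _ _
    _ = |quadRatio d x| + 2 * |halfLogDeriv d x| ^ 2 := by rw [abs_mul, abs_pow]; norm_num
    _ ≤ (jap x)⁻¹ ^ 2 + 2 * (jap x)⁻¹ ^ 2 := by gcongr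
    _ = _ := by ring

theorem abs_halfLogDeriv_cubic_le (hd : 0 < d) (hd1 : d ≤ 1) (x : ℝ) :
    |8 * halfLogDeriv d x ^ 3 - 6 * (halfLogDeriv d x * quadRatio d x)|
      ≤ 14 * (jap x)⁻¹ ^ 3 := by
  have hu := abs_halfLogDeriv_le hd hd1 x
  have hv := abs_quadRatio_le hd hd1 x
  have hj := (inv_pos.2 (jap_pos x)).le
  calc _ ≤ |8 * halfLogDeriv d x ^ 3| + |6 * (halfLogDeriv d x * quadRatio d x)| := abs_sub _ _
    _ = 8 * |halfLogDeriv d x| ^ 3 + 6 * (|halfLogDeriv d x| * |quadRatio d x|) := by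
      rw [abs_mul, abs_pow, abs_mul, abs_mul]; norm_num
    _ ≤ 8 * (jap x)⁻¹ ^ 3 + 6 * ((jap x)⁻¹ * (jap x)⁻¹ ^ 2) := by gcongr
    _ = _ := by ring

end

theorem abs_two_mul_mul_sub_mul_le {a b A B u v c : ℝ} (ha : |a| ≤ A) (hb : |b| ≤ B)
    (hu : |u| ≤ c) (hv : |v| ≤ c) : |2 * (a * u - b * v)| ≤ 2 * (A + B) * c := by
  have hA := (abs_nonneg a).trans ha
  have hB := (abs_nonneg b).trans hb
  calc _ = 2 * |a * u - b * v| := by rw [abs_mul]; norm_num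
    _ ≤ 2 * (|a| * |u| + |b| * |v|) := by
      rw [← abs_mul, ← abs_mul]
      gcongr
      exact abs_sub _ _
    _ ≤ 2 * (A * c + B * c) := by gcongr
    _ = _ := by ring

/-- The weight `(1 + x²)^a (1 + δx²)^{-b}`. -/
def quadWeight (a b δ x : ℝ) : ℝ := (1 + 1 * x ^ 2) ^ a * (1 + δ * x ^ 2) ^ (-b)

theorem Mmol_eq_quadWeight (N T₀ δ t x : ℝ) :
    Mmol N T₀ δ t x = quadWeight ((t * N - 1) / 2) ((T₀ * N + 4) / 2) δ x := by
  rw [Mmol, quadWeight, jap, Real.sqrt_eq_rpow, ← Real.rpow_mul (by positivity), one_mul]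
  congr 2
  ring

section

variable {a b A B δ : ℝ}

theorem quadWeight_pos (a b : ℝ) (hδ : 0 < δ) (x : ℝ) : 0 < quadWeight a b δ x := by
  unfold quadWeight
  positivity

theorem quadWeight_le_of_sq_le (ha : |a| ≤ A) (hb : 0 ≤ b) (hδ : 0 < δ) {x y : ℝ}
    (hyx : y ^ 2 ≤ x ^ 2) (hxy : x ^ 2 ≤ 2 * y ^ 2) :
    quadWeight a b δ x ≤ 2 ^ A * quadWeight a b δ y := by
  have hx : 0 < 1 + 1 * x ^ 2 := by positivity
  have hy : 0 < 1 + 1 * y ^ 2 := by positivity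
  have h₁ : (1 + 1 * x ^ 2) ^ a ≤ 2 ^ A * (1 + 1 * y ^ 2) ^ a := by
    rw [← div_le_iff₀ (by positivity), ← Real.div_rpow hx.le hy.le]
    have hone : 1 ≤ (1 + 1 * x ^ 2) / (1 + 1 * y ^ 2) := by
      rw [one_le_div hy]; linarith
    calc _ ≤ ((1 + 1 * x ^ 2) / (1 + 1 * y ^ 2)) ^ A :=
          Real.rpow_le_rpow_of_exponent_le hone ((le_abs_self a).trans ha)
      _ ≤ 2 ^ A := by
          apply Real.rpow_le_rpow (by positivity) _ ((abs_nonneg a).trans ha)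
          rw [div_le_iff₀ hy]; linarith
  have h₂ : (1 + δ * x ^ 2) ^ (-b) ≤ (1 + δ * y ^ 2) ^ (-b) := by
    apply Real.rpow_le_rpow_of_nonpos (by positivity) (by gcongr) (by linarith)
  unfold quadWeight
  rw [← mul_assoc]
  gcongr

/-- The logarithmic derivative of `quadWeight`. -/
def logDerivWeight (a b δ x : ℝ) : ℝ := 2 * (a * halfLogDeriv 1 x - b * halfLogDeriv δ x)

/-- The first derivative of `logDerivWeight`. -/
def logDerivWeight₁ (a b δ x : ℝ) : ℝ :=
  2 * (a * (quadRatio 1 x - 2 * halfLogDeriv 1 x ^ 2)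
    - b * (quadRatio δ x - 2 * halfLogDeriv δ x ^ 2))

/-- The second derivative of `logDerivWeight`. -/
def logDerivWeight₂ (a b δ x : ℝ) : ℝ :=
  2 * (a * (8 * halfLogDeriv 1 x ^ 3 - 6 * (halfLogDeriv 1 x * quadRatio 1 x))
    - b * (8 * halfLogDeriv δ x ^ 3 - 6 * (halfLogDeriv δ x * quadRatio δ x)))

theorem hasDerivAt_quadWeight (a b : ℝ) (hδ : 0 < δ) (x : ℝ) :
    HasDerivAt (quadWeight a b δ) (quadWeight a b δ x * logDerivWeight a b δ x) x := by
  refine HasDerivAt.congr_deriv ((hasDerivAt_one_add_mul_sq_rpow one_pos a x).mul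
    (hasDerivAt_one_add_mul_sq_rpow hδ (-b) x)) ?_
  rw [quadWeight, logDerivWeight]
  ring

theorem hasDerivAt_logDerivWeight (a b : ℝ) (hδ : 0 < δ) (x : ℝ) :
    HasDerivAt (logDerivWeight a b δ) (logDerivWeight₁ a b δ x) x :=
  (((hasDerivAt_halfLogDeriv one_pos x).const_mul a).sub
    ((hasDerivAt_halfLogDeriv hδ x).const_mul b)).const_mul 2

theorem hasDerivAt_logDerivWeight₁ (a b : ℝ) (hδ : 0 < δ) (x : ℝ) :
    HasDerivAt (logDerivWeight₁ a b δ) (logDerivWeight₂ a b δ x) x := by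
  have h : ∀ {d : ℝ}, 0 < d → HasDerivAt (fun y => quadRatio d y - 2 * halfLogDeriv d y ^ 2)
      (8 * halfLogDeriv d x ^ 3 - 6 * (halfLogDeriv d x * quadRatio d x)) x := by
    intro d hd
    refine HasDerivAt.congr_deriv ((hasDerivAt_quadRatio hd x).sub
      (((hasDerivAt_halfLogDeriv hd x).pow 2).const_mul 2)) ?_
    push_cast
    ring
  exact (((h one_pos).const_mul a).sub ((h hδ).const_mul b)).const_mul 2

theorem hasDerivAt_deriv_quadWeight (a b : ℝ) (hδ : 0 < δ) (x : ℝ) :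
    HasDerivAt (deriv (quadWeight a b δ))
      (quadWeight a b δ x * (logDerivWeight a b δ x ^ 2 + logDerivWeight₁ a b δ x)) x := by
  rw [funext fun y => (hasDerivAt_quadWeight a b hδ y).deriv]
  refine HasDerivAt.congr_deriv
    ((hasDerivAt_quadWeight a b hδ x).mul (hasDerivAt_logDerivWeight a b hδ x)) ?_
  ring

theorem hasDerivAt_deriv_deriv_quadWeight (a b : ℝ) (hδ : 0 < δ) (x : ℝ) :
    HasDerivAt (deriv (deriv (quadWeight a b δ)))
      (quadWeight a b δ x * (logDerivWeight a b δ x ^ 3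
        + 3 * (logDerivWeight a b δ x * logDerivWeight₁ a b δ x) + logDerivWeight₂ a b δ x)) x := by
  rw [funext fun y => (hasDerivAt_deriv_quadWeight a b hδ y).deriv]
  refine HasDerivAt.congr_deriv ((hasDerivAt_quadWeight a b hδ x).mul
    (((hasDerivAt_logDerivWeight a b hδ x).pow 2).add
      (hasDerivAt_logDerivWeight₁ a b hδ x))) ?_
  push_cast
  ring

theorem abs_logDerivWeight_le (ha : |a| ≤ A) (hb : |b| ≤ B) (hδ : 0 < δ) (hδ1 : δ ≤ 1) (x : ℝ) :
    |logDerivWeight a b δ x| ≤ 2 * (A + B) * (jap x)⁻¹ :=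
  abs_two_mul_mul_sub_mul_le ha hb (abs_halfLogDeriv_le one_pos le_rfl x)
    (abs_halfLogDeriv_le hδ hδ1 x)

theorem abs_logDerivWeight₁_le (ha : |a| ≤ A) (hb : |b| ≤ B) (hδ : 0 < δ) (hδ1 : δ ≤ 1) (x : ℝ) :
    |logDerivWeight₁ a b δ x| ≤ 2 * (A + B) * (3 * (jap x)⁻¹ ^ 2) :=
  abs_two_mul_mul_sub_mul_le ha hb (abs_quadRatio_sub_le one_pos le_rfl x)
    (abs_quadRatio_sub_le hδ hδ1 x)

theorem abs_logDerivWeight₂_le (ha : |a| ≤ A) (hb : |b| ≤ B) (hδ : 0 < δ) (hδ1 : δ ≤ 1) (x : ℝ) :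
    |logDerivWeight₂ a b δ x| ≤ 2 * (A + B) * (14 * (jap x)⁻¹ ^ 3) :=
  abs_two_mul_mul_sub_mul_le ha hb (abs_halfLogDeriv_cubic_le one_pos le_rfl x)
    (abs_halfLogDeriv_cubic_le hδ hδ1 x)

theorem abs_logDerivWeight_sq_add_le (ha : |a| ≤ A) (hb : |b| ≤ B) (hδ : 0 < δ) (hδ1 : δ ≤ 1)
    (x : ℝ) :
    |logDerivWeight a b δ x ^ 2 + logDerivWeight₁ a b δ x|
      ≤ (4 * (A + B) ^ 2 + 6 * (A + B)) * (jap x)⁻¹ ^ 2 := by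
  have h₀ := abs_logDerivWeight_le ha hb hδ hδ1 x
  have h₁ := abs_logDerivWeight₁_le ha hb hδ hδ1 x
  calc _ ≤ |logDerivWeight a b δ x| ^ 2 + |logDerivWeight₁ a b δ x| := by
        rw [← abs_pow]; exact abs_add_le _ _
    _ ≤ (2 * (A + B) * (jap x)⁻¹) ^ 2 + 2 * (A + B) * (3 * (jap x)⁻¹ ^ 2) := by gcongr
    _ = _ := by ring

theorem abs_logDerivWeight_cubic_le (ha : |a| ≤ A) (hb : |b| ≤ B) (hδ : 0 < δ) (hδ1 : δ ≤ 1)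
    (x : ℝ) :
    |logDerivWeight a b δ x ^ 3 + 3 * (logDerivWeight a b δ x * logDerivWeight₁ a b δ x)
        + logDerivWeight₂ a b δ x|
      ≤ (8 * (A + B) ^ 3 + 36 * (A + B) ^ 2 + 28 * (A + B)) * (jap x)⁻¹ ^ 3 := by
  have h₀ := abs_logDerivWeight_le ha hb hδ hδ1 x
  have h₁ := abs_logDerivWeight₁_le ha hb hδ hδ1 x
  have h₂ := abs_logDerivWeight₂_le ha hb hδ hδ1 x
  have h₀' := (abs_nonneg _).trans h₀
  calc _ ≤ |logDerivWeight a b δ x ^ 3|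
          + |3 * (logDerivWeight a b δ x * logDerivWeight₁ a b δ x)|
          + |logDerivWeight₂ a b δ x| := abs_add_three _ _ _
    _ = |logDerivWeight a b δ x| ^ 3
          + 3 * (|logDerivWeight a b δ x| * |logDerivWeight₁ a b δ x|)
          + |logDerivWeight₂ a b δ x| := by rw [abs_pow, abs_mul, abs_mul]; norm_num
    _ ≤ (2 * (A + B) * (jap x)⁻¹) ^ 3
          + 3 * ((2 * (A + B) * (jap x)⁻¹) * (2 * (A + B) * (3 * (jap x)⁻¹ ^ 2)))
          + 2 * (A + B) * (14 * (jap x)⁻¹ ^ 3) := by gcongr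
    _ = _ := by ring

theorem sq_le_sq_of_mem_uIcc_mul {c x z : ℝ} (hc : 0 ≤ c) (hc1 : c ≤ 1)
    (hz : z ∈ Set.uIcc (x * c) x) : (x * c) ^ 2 ≤ z ^ 2 ∧ z ^ 2 ≤ x ^ 2 := by
  rw [Set.mem_uIcc] at hz
  rcases le_total 0 x with hx | hx
  · have h₁ : 0 ≤ x * c := mul_nonneg hx hc
    have h₂ : x * c ≤ x := mul_le_of_le_one_right hx hc1
    constructor <;> rcases hz with hz | hz <;> nlinarith
  · have h₁ : x * c ≤ 0 := mul_nonpos_of_nonpos_of_nonneg hx hc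
    have h₂ : x ≤ x * c := by nlinarith
    constructor <;> rcases hz with hz | hz <;> nlinarith

/-- A function whose derivative is controlled by `⟨z⟩^{-(k+1)}` times the weight varies by at most
`(1 - c) ⟨x⟩^{-k}` times the weight between `x * c` and `x`. -/
theorem abs_sub_le_of_hasDerivAt_quadWeight (ha : |a| ≤ A) (hb : 0 ≤ b) (hδ : 0 < δ)
    {f g : ℝ → ℝ} {K : ℝ} (hK : 0 ≤ K) (k : ℕ)
    (hf : ∀ z, HasDerivAt f (quadWeight a b δ z * g z) z)
    (hg : ∀ z, |g z| ≤ K * (jap z)⁻¹ ^ (k + 1))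
    {c : ℝ} (hc : 0 ≤ c) (hc1 : c ≤ 1) (hc2 : 1 ≤ 2 * c ^ 2) (x : ℝ) :
    |f x - f (x * c)|
      ≤ 2 ^ A * K * 2 ^ (k + 1) * (1 - c) * (jap x)⁻¹ ^ k * quadWeight a b δ (x * c) := by
  have hM := quadWeight_pos a b hδ
  have hj := jap_pos x
  have hx2 : x ^ 2 ≤ 2 * (x * c) ^ 2 := by nlinarith [sq_nonneg x]
  have hbound : ∀ z ∈ Set.uIcc (x * c) x, ‖quadWeight a b δ z * g z‖
      ≤ (2 ^ A * quadWeight a b δ (x * c)) * (K * (2 * (jap x)⁻¹) ^ (k + 1)) := by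
    intro z hz
    obtain ⟨h₁, h₂⟩ := sq_le_sq_of_mem_uIcc_mul hc hc1 hz
    have hjz := jap_pos z
    rw [norm_mul, Real.norm_eq_abs, Real.norm_eq_abs, abs_of_pos (hM z)]
    have hJ : (jap z)⁻¹ ≤ 2 * (jap x)⁻¹ := jap_inv_le_two_mul (by linarith)
    have hz' := quadWeight_le_of_sq_le ha hb hδ h₁ (h₂.trans hx2)
    have hg' : |g z| ≤ K * (2 * (jap x)⁻¹) ^ (k + 1) := (hg z).trans (by gcongr)
    exact mul_le_mul hz' hg' (abs_nonneg _) ((hM z).le.trans hz')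
  have hmv := (convex_uIcc (x * c) x).norm_image_sub_le_of_norm_hasDerivWithin_le
    (fun z _ => (hf z).hasDerivWithinAt) hbound Set.left_mem_uIcc Set.right_mem_uIcc
  rw [Real.norm_eq_abs, Real.norm_eq_abs] at hmv
  have hdist : |x - x * c| ≤ jap x * (1 - c) := by
    rw [show x - x * c = x * (1 - c) by ring, abs_mul, abs_of_nonneg (sub_nonneg.2 hc1)]
    exact mul_le_mul_of_nonneg_right (abs_le_jap x) (sub_nonneg.2 hc1)
  calc _ ≤ _ := hmv
    _ ≤ (2 ^ A * quadWeight a b δ (x * c)) * (K * (2 * (jap x)⁻¹) ^ (k + 1))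
          * (jap x * (1 - c)) := by
        have := hM (x * c)
        gcongr
    _ = _ := by
        rw [mul_pow, pow_succ (jap x)⁻¹ k]
        field_simp

end

theorem hasDerivAt_Mmol_time (N T₀ δ t x : ℝ) :
    HasDerivAt (fun τ => Mmol N T₀ δ τ x) (N * Real.log (jap x) * Mmol N T₀ δ t x) t := by
  have h : HasDerivAt (fun τ : ℝ => τ * N - 1) N t := by
    simpa using ((hasDerivAt_id t).mul_const N).sub_const 1
  refine HasDerivAt.congr_deriv ((h.const_rpow (jap_pos x)).mul_const
    ((1 + δ * x ^ 2) ^ (-((T₀ * N + 4) / 2)))) ?_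
  rw [Mmol]
  ring

theorem one_le_two_mul_cos_sq {θ : ℝ} (hθ : |θ| ≤ π / 4) : 1 ≤ 2 * Real.cos θ ^ 2 := by
  obtain ⟨h₁, h₂⟩ := abs_le.1 hθ
  have := Real.cos_nonneg_of_neg_pi_div_two_le_of_le (x := 2 * θ) (by linarith) (by linarith)
  rw [Real.cos_two_mul] at this
  linarith

theorem one_sub_cos_eq (θ : ℝ) : 1 - Real.cos θ = 2 * Real.sin (θ / 2) ^ 2 := by
  have h := Real.cos_two_mul (θ / 2)
  rw [mul_div_cancel₀ θ two_ne_zero, Real.cos_sq'] at h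
  linarith

/-- Symbolic estimates for the polynomial mollifier `M_δ`:
the `∂_t` bound with logarithmic loss and the difference bounds for `M_δ`,
`∂_ξ M_δ` and `∂²_ξ M_δ` along `ξ ↦ ξ cos θ`, uniformly in `δ ∈ (0,1)`. -/
theorem Mmol_bounds (N T₀ : ℝ) (hN : 0 < N) (hT₀ : 0 < T₀) :
    ∃ C : ℝ, 0 < C ∧ ∀ δ : ℝ, 0 < δ → δ < 1 → ∀ t ∈ Set.Icc (0 : ℝ) T₀, ∀ ξ : ℝ,
      (|deriv (fun τ : ℝ => Mmol N T₀ δ τ ξ) t|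
          ≤ N * Real.log (jap ξ) * Mmol N T₀ δ t ξ) ∧
      ∀ θ : ℝ, |θ| ≤ Real.pi / 4 →
        Mmol N T₀ δ t ξ ≤ C * Mmol N T₀ δ t (ξ * Real.cos θ) ∧
        |Mmol N T₀ δ t ξ - Mmol N T₀ δ t (ξ * Real.cos θ)|
          ≤ C * Real.sin (θ / 2) ^ 2 * Mmol N T₀ δ t (ξ * Real.cos θ) ∧
        |deriv (fun ζ : ℝ => Mmol N T₀ δ t ζ) ξ
            - deriv (fun ζ : ℝ => Mmol N T₀ δ t ζ) (ξ * Real.cos θ)|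
          ≤ C * Real.sin (θ / 2) ^ 2 * jap ξ ^ (-(1 : ℝ)) * Mmol N T₀ δ t (ξ * Real.cos θ) ∧
        |deriv (deriv (fun ζ : ℝ => Mmol N T₀ δ t ζ)) ξ
            - deriv (deriv (fun ζ : ℝ => Mmol N T₀ δ t ζ)) (ξ * Real.cos θ)|
          ≤ C * Real.sin (θ / 2) ^ 2 * jap ξ ^ (-(2 : ℝ)) * Mmol N T₀ δ t (ξ * Real.cos θ) := by
  set A : ℝ := T₀ * N + 1 with hA
  set b : ℝ := (T₀ * N + 4) / 2 with hb
  have hTN : 0 < T₀ * N := mul_pos hT₀ hN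
  have hb0 : 0 < b := by positivity
  have hL : 0 < A + b := by positivity
  set K : ℝ := 8 * (A + b) ^ 3 + 40 * (A + b) ^ 2 + 36 * (A + b) with hK
  refine ⟨2 ^ A * (1 + K * 16), by positivity, fun δ hδ hδ1 t ht ξ => ⟨?_, fun θ hθ => ?_⟩⟩
  · have hM : 0 < Mmol N T₀ δ t ξ := by
      rw [Mmol_eq_quadWeight]
      exact quadWeight_pos _ _ hδ ξ
    rw [(hasDerivAt_Mmol_time N T₀ δ t ξ).deriv, abs_of_nonneg]
    have := Real.log_nonneg (one_le_jap ξ)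
    positivity
  obtain ⟨hθ₁, hθ₂⟩ := abs_le.1 hθ
  have hc : 0 ≤ Real.cos θ :=
    Real.cos_nonneg_of_neg_pi_div_two_le_of_le (by linarith [Real.pi_pos])
      (by linarith [Real.pi_pos])
  have hc1 := Real.cos_le_one θ
  have hc2 := one_le_two_mul_cos_sq hθ
  simp only [Mmol_eq_quadWeight]
  rw [← hb]
  set a : ℝ := (t * N - 1) / 2
  have ha : |a| ≤ A := by
    have h₀ : 0 ≤ t * N := mul_nonneg ht.1 hN.le
    have h₁ : t * N ≤ T₀ * N := mul_le_mul_of_nonneg_right ht.2 hN.le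
    rw [abs_le]
    constructor <;> simp only [a, A] <;> linarith
  have hbb : |b| ≤ b := (abs_of_pos hb0).le
  have hM := quadWeight_pos a b hδ (ξ * Real.cos θ)
  have hj := jap_pos ξ
  have diff : ∀ {f g : ℝ → ℝ} {K' : ℝ} (k : ℕ), 0 ≤ K' → K' ≤ K → k ≤ 2 →
      (∀ z, HasDerivAt f (quadWeight a b δ z * g z) z) →
      (∀ z, |g z| ≤ K' * (jap z)⁻¹ ^ (k + 1)) →
      |f ξ - f (ξ * Real.cos θ)| ≤ 2 ^ A * (1 + K * 16) * Real.sin (θ / 2) ^ 2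
        * (jap ξ)⁻¹ ^ k * quadWeight a b δ (ξ * Real.cos θ) := by
    intro f g K' k hK' hKK hk hf hg
    refine (abs_sub_le_of_hasDerivAt_quadWeight ha hb0.le hδ hK' k hf hg hc hc1 hc2 ξ).trans ?_
    rw [one_sub_cos_eq]
    have hpow : (2 : ℝ) ^ (k + 1) ≤ 2 ^ 3 := pow_le_pow_right₀ one_le_two (by omega)
    have hconst : K' * 2 ^ (k + 1) * 2 ≤ 1 + K * 16 := by
      nlinarith [mul_le_mul hKK hpow (by positivity) (hK'.trans hKK)]
    calc _ = 2 ^ A * (K' * 2 ^ (k + 1) * 2) * Real.sin (θ / 2) ^ 2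
        * (jap ξ)⁻¹ ^ k * quadWeight a b δ (ξ * Real.cos θ) := by ring
      _ ≤ _ := by gcongr
  refine ⟨?_, ?_, ?_, ?_⟩
  · have h := quadWeight_le_of_sq_le ha hb0.le hδ (x := ξ) (y := ξ * Real.cos θ)
      (sq_le_sq_of_mem_uIcc_mul hc hc1 Set.right_mem_uIcc).1 (by nlinarith [sq_nonneg ξ])
    refine h.trans (mul_le_mul_of_nonneg_right ?_ hM.le)
    exact le_mul_of_one_le_right (by positivity) (le_add_of_nonneg_right (by positivity))
  · simpa using diff (K' := 2 * (A + b)) 0 (by positivity)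
      (by rw [hK]; nlinarith [pow_pos hL 2, pow_pos hL 3]) (by norm_num)
      (hasDerivAt_quadWeight a b hδ)
      (fun z => by simpa using abs_logDerivWeight_le ha hbb hδ hδ1.le z)
  · rw [Real.rpow_neg_one, ← pow_one (jap ξ)⁻¹]
    exact diff 1 (by positivity) (by rw [hK]; nlinarith [pow_pos hL 2, pow_pos hL 3])
      (by norm_num) (hasDerivAt_deriv_quadWeight a b hδ)
      (abs_logDerivWeight_sq_add_le ha hbb hδ hδ1.le)
  · rw [Real.rpow_neg hj.le, Real.rpow_two, ← inv_pow]
    exact diff 2 (by positivity) (by rw [hK]; nlinarith [pow_pos hL 2, pow_pos hL 3])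
      le_rfl (hasDerivAt_deriv_deriv_quadWeight a b hδ)
      (abs_logDerivWeight_cubic_le ha hbb hδ hδ1.le)
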